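/- Sub-feasibility of the asynchronous Sinkhorn iterates: for every ℓ ≥ 1 one has Σ_{y∈Y} π^ℓ(x,y) ≤ μ(x) for all x ∈ X and Σ_{x∈X} π^ℓ(x,y) ≤ ν(y) for all y ∈ Y. -/

import Mathlib

/-- One `u`-update of the Sinkhorn algorithm: `u(x) = μ(x) / Σ_y K(x,y) v(y)`. -/
noncomputable def uOf {X Y : Type*} [Fintype Y] (K : X → Y → ℝ) (μ : X → ℝ)
    (v : Y → ℝ) : X → ℝ :=
  fun x => μ x / ∑ y, K x y * v y

/-- One `v̂`-update of the Sinkhorn algorithm: `v̂(y) = ν(y) / Σ_x K(x,y) u(x)`. -/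
noncomputable def vhatOf {X Y : Type*} [Fintype X] (K : X → Y → ℝ) (ν : Y → ℝ)
    (u : X → ℝ) : Y → ℝ :=
  fun y => ν y / ∑ x, K x y * u x

/-- The `v`-iterates of the asynchronous Sinkhorn algorithm:
`v⁰ = v0`, `v^{ℓ+1}(y) = min (v^ℓ(y), v̂^{ℓ+1}(y))` with
`v̂^{ℓ+1} = vhatOf K ν (uOf K μ (v^ℓ))`. -/
noncomputable def sinkV {X Y : Type*} [Fintype X] [Fintype Y] (K : X → Y → ℝ)
    (μ : X → ℝ) (ν : Y → ℝ) (v0 : Y → ℝ) : ℕ → Y → ℝ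
  | 0 => v0
  | ℓ + 1 => fun y =>
      min (sinkV K μ ν v0 ℓ y) (vhatOf K ν (uOf K μ (sinkV K μ ν v0 ℓ)) y)

section

variable {X Y : Type*} {K : X → Y → ℝ} {μ : X → ℝ} {ν : Y → ℝ}

theorem uOf_pos [Fintype Y] [Nonempty Y] (hK : ∀ x y, 0 < K x y) (hμ : ∀ x, 0 < μ x)
    {v : Y → ℝ} (hv : ∀ y, 0 < v y) (x : X) : 0 < uOf K μ v x :=
  div_pos (hμ x) (Finset.sum_pos (fun y _ => mul_pos (hK x y) (hv y)) Finset.univ_nonempty)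

theorem vhatOf_pos [Fintype X] [Nonempty X] (hK : ∀ x y, 0 < K x y) (hν : ∀ y, 0 < ν y)
    {u : X → ℝ} (hu : ∀ x, 0 < u x) (y : Y) : 0 < vhatOf K ν u y :=
  div_pos (hν y) (Finset.sum_pos (fun x _ => mul_pos (hK x y) (hu x)) Finset.univ_nonempty)

theorem sinkV_pos [Fintype X] [Fintype Y] [Nonempty X] [Nonempty Y]
    (hK : ∀ x y, 0 < K x y) (hμ : ∀ x, 0 < μ x) (hν : ∀ y, 0 < ν y)
    {v0 : Y → ℝ} (hv0 : ∀ y, 0 < v0 y) (n : ℕ) (y : Y) : 0 < sinkV K μ ν v0 n y := by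
  induction n generalizing y with
  | zero => exact hv0 y
  | succ n ih => exact lt_min (ih y) (vhatOf_pos hK hν (uOf_pos hK hμ ih) y)

theorem sum_uOf_mul_le [Fintype Y] [Nonempty Y] (hK : ∀ x y, 0 < K x y) (hμ : ∀ x, 0 < μ x)
    {v w : Y → ℝ} (hv : ∀ y, 0 < v y) (hwv : ∀ y, w y ≤ v y) (x : X) :
    ∑ y, uOf K μ v x * K x y * w y ≤ μ x := by
  have hpos : 0 < ∑ y, K x y * v y :=
    Finset.sum_pos (fun y _ => mul_pos (hK x y) (hv y)) Finset.univ_nonempty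
  calc ∑ y, uOf K μ v x * K x y * w y
      ≤ ∑ y, uOf K μ v x * K x y * v y := Finset.sum_le_sum fun y _ =>
        mul_le_mul_of_nonneg_left (hwv y) (mul_pos (uOf_pos hK hμ hv x) (hK x y)).le
    _ = uOf K μ v x * ∑ y, K x y * v y := by simp only [Finset.mul_sum, mul_assoc]
    _ = μ x := div_mul_cancel₀ _ hpos.ne'

theorem sum_mul_le_of_le_vhatOf [Fintype X] [Nonempty X] (hK : ∀ x y, 0 < K x y)
    {u : X → ℝ} (hu : ∀ x, 0 < u x) {w : Y → ℝ} (hw : ∀ y, w y ≤ vhatOf K ν u y) (y : Y) :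
    ∑ x, u x * K x y * w y ≤ ν y := by
  have hpos : 0 < ∑ x, K x y * u x :=
    Finset.sum_pos (fun x _ => mul_pos (hK x y) (hu x)) Finset.univ_nonempty
  calc ∑ x, u x * K x y * w y
      = w y * ∑ x, K x y * u x := by
        rw [Finset.mul_sum]
        exact Finset.sum_congr rfl fun x _ => by ring
    _ ≤ ν y := (le_div_iff₀ hpos).mp (hw y)

end

theorem async_sinkhorn_subfeasible
    {X Y : Type*} [Fintype X] [Fintype Y] [Nonempty X] [Nonempty Y]
    (μ : X → ℝ) (ν : Y → ℝ) (hμ : ∀ x, 0 < μ x) (hν : ∀ y, 0 < ν y)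
    (hμ1 : ∑ x, μ x = 1) (hν1 : ∑ y, ν y = 1)
    (C : ℝ) (hC : 0 ≤ C) (c : X → Y → ℝ) (hc : ∀ x y, 0 ≤ c x y ∧ c x y ≤ C)
    (ε : ℝ) (hε : 0 < ε)
    (K : X → Y → ℝ) (hK : ∀ x y, K x y = Real.exp (-(c x y) / ε) * μ x * ν y)
    (v0 : Y → ℝ) (hv0 : ∀ y, 0 < v0 y)
    (v : ℕ → Y → ℝ) (hv : ∀ ℓ, v ℓ = sinkV K μ ν v0 ℓ)
    (u : ℕ → X → ℝ) (hu : ∀ ℓ, u ℓ = uOf K μ (v (ℓ - 1)))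
    (vhat : ℕ → Y → ℝ) (hvhat : ∀ ℓ, vhat ℓ = vhatOf K ν (u ℓ))
    (π : ℕ → X → Y → ℝ) (hπ : ∀ ℓ x y, π ℓ x y = u ℓ x * K x y * v ℓ y)
    (q : ℕ → ℝ) (hq : ∀ ℓ, q ℓ = ∑ x, ∑ y, π ℓ x y)
    (α : ℕ → X → ℝ) (hα : ∀ ℓ x, α ℓ x = ε * Real.log (u ℓ x)) :
    ∀ ℓ : ℕ, 1 ≤ ℓ →
      (∀ x, ∑ y, π ℓ x y ≤ μ x) ∧ (∀ y, ∑ x, π ℓ x y ≤ ν y) := by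
  have hKpos : ∀ x y, 0 < K x y := fun x y => by
    rw [hK]
    exact mul_pos (mul_pos (Real.exp_pos _) (hμ x)) (hν y)
  have hvpos : ∀ n y, 0 < sinkV K μ ν v0 n y := sinkV_pos hKpos hμ hν hv0
  intro ℓ hℓ
  obtain ⟨n, rfl⟩ := Nat.exists_eq_add_of_le' hℓ
  simp only [hπ, hu, hv, Nat.add_sub_cancel]
  exact ⟨sum_uOf_mul_le hKpos hμ (hvpos n) fun y => min_le_left _ _,
    sum_mul_le_of_le_vhatOf hKpos (uOf_pos hKpos hμ (hvpos n)) fun y => min_le_right _ _⟩
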